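/- arXiv:1411.3575 — 2 statements merged into one kernel-verified Lean document; each statement's English description precedes it below -/
import Mathlib

section
/- Let Φ : [0,∞) → ℝ be convex, twice differentiable and strictly convex on (0,∞), with nonincreasing second derivative and Φ(0) finite, and suppose the function Ψ(u) = (Φ(u) − Φ(0))/u is concave on (0,∞) and differentiable at u = 1. Then for every admissible pair (μ,K) on finite alphabets, η_Φ(μ,K) ≤ (2Ψ'(1)/Φ''(1/μ*)) · S(μ,K)², where μ* = min_{x ∈ X} μ(x). -/
open Finset

noncomputable section

namespace SDPI

variable {X Y : Type} [Fintype X] [Fintype Y]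

def IsDist (μ : X → ℝ) : Prop := (∀ x, 0 ≤ μ x) ∧ ∑ x, μ x = 1

def IsPosDist (μ : X → ℝ) : Prop := (∀ x, 0 < μ x) ∧ ∑ x, μ x = 1

def IsChannel (K : X → Y → ℝ) : Prop :=
  (∀ x y, 0 ≤ K x y) ∧ ∀ x, ∑ y, K x y = 1

def push (μ : X → ℝ) (K : X → Y → ℝ) : Y → ℝ := fun y => ∑ x, μ x * K x y

def fDiv (Φ : ℝ → ℝ) (ν μ : X → ℝ) : ℝ := (∑ x, μ x * Φ (ν x / μ x)) - Φ 1

def eta (Φ : ℝ → ℝ) (μ : X → ℝ) (K : X → Y → ℝ) : ℝ :=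
  sSup { r | ∃ ν : X → ℝ, IsDist ν ∧ ν ≠ μ ∧
    r = fDiv Φ (push ν K) (push μ K) / fDiv Φ ν μ }

def etaSup (Φ : ℝ → ℝ) (K : X → Y → ℝ) : ℝ :=
  sSup { r | ∃ μ : X → ℝ, IsPosDist μ ∧ r = eta Φ μ K }

def maxCorr (μ : X → ℝ) (K : X → Y → ℝ) : ℝ :=
  sSup { r | ∃ (f : X → ℝ) (g : Y → ℝ),
    (∑ x, μ x * f x) = 0 ∧ (∑ y, push μ K y * g y) = 0 ∧
    (∑ x, μ x * (f x) ^ 2) = 1 ∧ (∑ y, push μ K y * (g y) ^ 2) = 1 ∧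
    r = ∑ x, ∑ y, μ x * K x y * (f x * g y) }

def adjoint (μ : X → ℝ) (K : X → Y → ℝ) : Y → X → ℝ :=
  fun y x => K x y * μ x / push μ K y

def Ent (Φ : ℝ → ℝ) (μ : X → ℝ) (f : X → ℝ) : ℝ :=
  (∑ x, μ x * Φ (f x)) - Φ (∑ x, μ x * f x)

def Var (μ : X → ℝ) (f : X → ℝ) : ℝ :=
  ∑ x, μ x * (f x - ∑ x', μ x' * f x') ^ 2

def condExp (μ : X → ℝ) (K : X → Y → ℝ) (f : X → ℝ) : Y → ℝ :=
  fun y => (∑ x, μ x * K x y * f x) / push μ K y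

def calE (μ : X → ℝ) (K : X → Y → ℝ) (f g : X → ℝ) : ℝ :=
  ∑ x, ∑ y, μ x * K x y *
    ((f x - condExp μ K f y) * (g x - condExp μ K g y))

def dirichlet (μ : X → ℝ) (M : X → X → ℝ) (f g : X → ℝ) : ℝ :=
  (1 / 2) * ∑ x, ∑ x', μ x * M x x' * ((f x - f x') * (g x - g x'))

def Homogeneous (Φ : ℝ → ℝ) : Prop :=
  ∃ κ : ℝ → ℝ, (∀ c : ℝ, 0 < c → 0 < κ c) ∧
    ∀ (c : ℝ), 0 < c → ∀ (Z : Type) [Fintype Z], ∀ (μ : Z → ℝ),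
      IsDist μ → ∀ f : Z → ℝ, (∀ z, 0 ≤ f z) →
        Ent Φ μ (fun z => c * f z) = κ c * Ent Φ μ f

def Subadditive (Φ : ℝ → ℝ) : Prop :=
  ∀ (n : ℕ) (Z : Fin n → Type) [∀ i, Fintype (Z i)],
    ∀ (μ : ∀ i, Z i → ℝ), (∀ i, IsDist (μ i)) →
    ∀ f : (∀ i, Z i) → ℝ, (∀ z, 0 ≤ f z) →
      Ent Φ (fun z : ∀ i, Z i => ∏ i, μ i (z i)) f ≤
        ∑ i : Fin n,
          ((∑ z : ∀ j, Z j, (∏ j, μ j (z j)) * Φ (f z)) -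
            ∑ z : ∀ j, Z j, (∏ j, μ j (z j)) *
              Φ (∑ w : Z i, μ i w * f (Function.update z i w)))


section Divergence

/-- The `χ²`-divergence of `ν` from `μ`. -/
def chiSq (ν μ : X → ℝ) : ℝ := ∑ x, μ x * (ν x / μ x - 1) ^ 2

lemma chiSq_eq {ν μ : X → ℝ} (hμ : IsPosDist μ) (hν : IsDist ν) :
    chiSq ν μ = ∑ x, ν x * (ν x / μ x - 1) := by
  have h : ∀ x, μ x * (ν x / μ x - 1) ^ 2 = ν x * (ν x / μ x - 1) - (ν x - μ x) := fun x => by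
    have := (hμ.1 x).ne'
    field_simp
  simp only [chiSq, h, sum_sub_distrib, hν.2, hμ.2, sub_self, sub_zero]

lemma sum_mul_div_sub_one {ν μ : X → ℝ} (hμ : IsPosDist μ) (hν : IsDist ν) :
    ∑ x, μ x * (ν x / μ x - 1) = 0 := by
  have h : ∀ x, μ x * (ν x / μ x - 1) = ν x - μ x := fun x => by
    have := (hμ.1 x).ne'
    field_simp
  simp only [h, sum_sub_distrib, hν.2, hμ.2, sub_self]

lemma chiSq_nonneg {ν μ : X → ℝ} (hμ : IsPosDist μ) : 0 ≤ chiSq ν μ :=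
  sum_nonneg fun x _ => mul_nonneg (hμ.1 x).le (sq_nonneg _)

lemma chiSq_pos {ν μ : X → ℝ} (hμ : IsPosDist μ) (hne : ν ≠ μ) : 0 < chiSq ν μ := by
  obtain ⟨x, hx⟩ := Function.ne_iff.mp hne
  refine sum_pos' (fun x _ => mul_nonneg (hμ.1 x).le (sq_nonneg _)) ⟨x, mem_univ x, ?_⟩
  refine mul_pos (hμ.1 x) (sq_pos_of_ne_zero ?_)
  rwa [sub_ne_zero, Ne, div_eq_one_iff_eq (hμ.1 x).ne']

lemma fDiv_le_mul_chiSq {Φ : ℝ → ℝ} {b d : ℝ} {ν μ : X → ℝ} (hμ : IsPosDist μ) (hν : IsDist ν)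
    (hΦ : ∀ u, 0 ≤ u → Φ u ≤ Φ 1 + b * (u - 1) + d * (u - 1) ^ 2) :
    fDiv Φ ν μ ≤ d * chiSq ν μ := by
  have h : ∑ x, μ x * Φ (ν x / μ x) ≤
      ∑ x, (Φ 1 * μ x + b * (μ x * (ν x / μ x - 1)) + d * (μ x * (ν x / μ x - 1) ^ 2)) := by
    refine sum_le_sum fun x _ => ?_
    have := mul_le_mul_of_nonneg_left (hΦ _ (div_nonneg (hν.1 x) (hμ.1 x).le)) (hμ.1 x).le
    linarith
  simp only [sum_add_distrib, ← mul_sum, hμ.2, sum_mul_div_sub_one hμ hν] at h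
  simp only [fDiv, chiSq]
  linarith

lemma mul_chiSq_le_fDiv {Φ : ℝ → ℝ} {b d T : ℝ} {ν μ : X → ℝ} (hμ : IsPosDist μ) (hν : IsDist ν)
    (hT : ∀ x, ν x / μ x ≤ T)
    (hΦ : ∀ u, 0 ≤ u → u ≤ T → Φ 1 + b * (u - 1) + d * (u - 1) ^ 2 ≤ Φ u) :
    d * chiSq ν μ ≤ fDiv Φ ν μ := by
  have h : ∑ x, (Φ 1 * μ x + b * (μ x * (ν x / μ x - 1)) + d * (μ x * (ν x / μ x - 1) ^ 2)) ≤
      ∑ x, μ x * Φ (ν x / μ x) := by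
    refine sum_le_sum fun x _ => ?_
    have := mul_le_mul_of_nonneg_left
      (hΦ _ (div_nonneg (hν.1 x) (hμ.1 x).le) (hT x)) (hμ.1 x).le
    linarith
  simp only [sum_add_distrib, ← mul_sum, hμ.2, sum_mul_div_sub_one hμ hν] at h
  simp only [fDiv, chiSq]
  linarith

end Divergence

section Correlation

lemma IsDist.push {μ : X → ℝ} {K : X → Y → ℝ} (hμ : IsDist μ) (hK : IsChannel K) :
    IsDist (push μ K) := by
  refine ⟨fun y => sum_nonneg fun x _ => mul_nonneg (hμ.1 x) (hK.1 x y), ?_⟩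
  simp only [SDPI.push]
  rw [sum_comm]
  simp only [← mul_sum, hK.2, mul_one, hμ.2]

lemma IsPosDist.isDist {μ : X → ℝ} (hμ : IsPosDist μ) : IsDist μ := ⟨fun x => (hμ.1 x).le, hμ.2⟩

lemma le_maxCorr {μ : X → ℝ} {K : X → Y → ℝ} (hμ : IsDist μ) (hK : IsChannel K)
    {f : X → ℝ} {g : Y → ℝ} (hf : ∑ x, μ x * f x = 0) (hg : ∑ y, push μ K y * g y = 0)
    (hf2 : ∑ x, μ x * (f x) ^ 2 = 1) (hg2 : ∑ y, push μ K y * (g y) ^ 2 = 1) :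
    ∑ x, ∑ y, μ x * K x y * (f x * g y) ≤ maxCorr μ K := by
  refine le_csSup ⟨1, ?_⟩ ⟨f, g, hf, hg, hf2, hg2, rfl⟩
  rintro r ⟨f, g, -, -, hf2, hg2, rfl⟩
  have h : ∑ x, ∑ y, μ x * K x y * (f x * g y) ≤
      ∑ x, ∑ y, (1 / 2 * (K x y * (μ x * f x ^ 2)) + 1 / 2 * (μ x * K x y * g y ^ 2)) := by
    refine sum_le_sum fun x _ => sum_le_sum fun y _ => ?_
    have := mul_nonneg (mul_nonneg (hμ.1 x) (hK.1 x y)) (sq_nonneg (f x - g y))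
    linarith
  have h1 : ∑ x, ∑ y, K x y * (μ x * f x ^ 2) = 1 := by
    simp only [← sum_mul, hK.2, one_mul, hf2]
  have h2 : ∑ x, ∑ y, μ x * K x y * g y ^ 2 = 1 := by
    rw [sum_comm]
    simp only [← sum_mul]
    exact hg2
  simp only [sum_add_distrib, ← mul_sum, h1, h2] at h
  linarith

lemma chiSq_push_le {μ ν : X → ℝ} {K : X → Y → ℝ} (hμ : IsPosDist μ) (hK : IsChannel K)
    (hadm : ∀ y, 0 < push μ K y) (hν : IsDist ν) (hne : ν ≠ μ) :
    chiSq (push ν K) (push μ K) ≤ maxCorr μ K ^ 2 * chiSq ν μ := by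
  have hpμ : IsPosDist (push μ K) := ⟨hadm, (hμ.isDist.push hK).2⟩
  have hV := chiSq_pos hμ hne
  set V := chiSq ν μ with hVdef
  set W := chiSq (push ν K) (push μ K) with hWdef
  rcases (chiSq_nonneg hpμ : 0 ≤ W).eq_or_lt with hW | hW
  · rw [hWdef, ← hW]
    positivity
  have normalize : ∀ {Z : Type} [Fintype Z] (p h : Z → ℝ) (c : ℝ), 0 < c →
      ∑ z, p z * h z = 0 → ∑ z, p z * h z ^ 2 = c →
      ∑ z, p z * (h z / √c) = 0 ∧ ∑ z, p z * (h z / √c) ^ 2 = 1 := by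
    intro Z _ p h c hc h0 h2
    constructor
    · simp only [← mul_div_assoc, ← sum_div, h0, zero_div]
    · simp only [div_pow, Real.sq_sqrt hc.le, ← mul_div_assoc, ← sum_div, h2, div_self hc.ne']
  obtain ⟨hf, hf2⟩ := normalize μ (fun x => ν x / μ x - 1) V hV (sum_mul_div_sub_one hμ hν) rfl
  obtain ⟨hg, hg2⟩ := normalize (push μ K) (fun y => push ν K y / push μ K y - 1) W hW
    (sum_mul_div_sub_one hpμ (hν.push hK)) rfl
  have hle := le_maxCorr hμ.isDist hK hf hg hf2 hg2
  have hcross : ∑ x, ∑ y, μ x * K x y *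
      ((ν x / μ x - 1) / √V * ((push ν K y / push μ K y - 1) / √W)) = W / (√V * √W) := by
    have h : ∀ x y, μ x * K x y *
        ((ν x / μ x - 1) / √V * ((push ν K y / push μ K y - 1) / √W)) =
        (ν x * K x y * (push ν K y / push μ K y - 1)
          - μ x * K x y * (push ν K y / push μ K y - 1)) / (√V * √W) := fun x y => by
      have hx : μ x * (ν x / μ x) = ν x := mul_div_cancel₀ _ (hμ.1 x).ne'
      rw [div_mul_div_comm, ← mul_div_assoc]
      congr 1
      linear_combination K x y * (push ν K y / push μ K y - 1) * hx
    simp only [h, ← sum_div]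
    congr 1
    rw [sum_comm]
    simp only [sum_sub_distrib, ← sum_mul]
    have h0 := sum_mul_div_sub_one hpμ (hν.push hK)
    have h1 := chiSq_eq hpμ (hν.push hK)
    simp only [push] at h0 h1 hWdef ⊢
    rw [h0, hWdef, h1, sub_zero]
  rw [hcross, div_mul_eq_div_div_swap, Real.div_sqrt, div_le_iff₀ (Real.sqrt_pos.mpr hV)] at hle
  have := pow_le_pow_left₀ (Real.sqrt_nonneg W) hle 2
  rwa [mul_pow, Real.sq_sqrt hW.le, Real.sq_sqrt hV.le] at this

end Correlation

section ConvexFunction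

variable {Φ Φ' Φ'' : ℝ → ℝ}

lemma second_deriv_pos (hd1 : ∀ u ∈ Set.Ioi (0 : ℝ), HasDerivAt Φ (Φ' u) u)
    (hd2 : ∀ u ∈ Set.Ioi (0 : ℝ), HasDerivAt Φ' (Φ'' u) u)
    (hstrict : StrictConvexOn ℝ (Set.Ioi 0) Φ) (hanti : AntitoneOn Φ'' (Set.Ioi 0))
    {T : ℝ} (hT : 0 < T) : 0 < Φ'' T := by
  have hlt : Φ' T < Φ' (T + 1) := by
    have hT1 : 0 < T + 1 := by linarith
    exact (hstrict.lt_slope_of_hasDerivAt hT hT1 (by linarith) (hd1 T hT)).trans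
      (hstrict.slope_lt_of_hasDerivAt hT hT1 (by linarith) (hd1 _ hT1))
  obtain ⟨ξ, hξ, hξ'⟩ := exists_hasDerivAt_eq_slope Φ' Φ'' (by linarith : T < T + 1)
    (fun u hu => (hd2 u (hT.trans_le hu.1)).continuousAt.continuousWithinAt)
    (fun u hu => hd2 u (hT.trans hu.1))
  have hpos : 0 < Φ'' ξ := by
    rw [hξ']
    exact div_pos (by linarith) (by linarith)
  exact hpos.trans_le (hanti hT (hT.trans hξ.1) hξ.1.le)

lemma quadratic_le (hconv : ConvexOn ℝ (Set.Ici 0) Φ)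
    (hd1 : ∀ u ∈ Set.Ioi (0 : ℝ), HasDerivAt Φ (Φ' u) u)
    (hd2 : ∀ u ∈ Set.Ioi (0 : ℝ), HasDerivAt Φ' (Φ'' u) u)
    (hanti : AntitoneOn Φ'' (Set.Ioi 0)) {T : ℝ} (hT : 1 ≤ T) (hpos : 0 < Φ'' T)
    {u : ℝ} (hu0 : 0 ≤ u) (huT : u ≤ T) :
    Φ 1 + Φ' 1 * (u - 1) + Φ'' T / 2 * (u - 1) ^ 2 ≤ Φ u := by
  set c := Φ'' T with hc
  have hT0 : 0 < T := by linarith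
  let φ : ℝ → ℝ := fun t => Φ t - c / 2 * (t - 1) ^ 2
  have hφ1 : ∀ t, 0 < t → HasDerivAt φ (Φ' t - c * (t - 1)) t := fun t ht => by
    have := (hd1 t ht).sub ((((hasDerivAt_id t).sub_const 1).pow 2).const_mul (c / 2))
    refine this.congr_deriv ?_
    simp only [id, Nat.cast_ofNat]
    ring
  have hφ2 : ∀ t, 0 < t → HasDerivAt (fun t => Φ' t - c * (t - 1)) (Φ'' t - c) t := fun t ht => by
    have := (hd2 t ht).sub (((hasDerivAt_id t).sub_const 1).const_mul c)
    exact this.congr_deriv (by simp)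
  have hφ : ConvexOn ℝ (Set.Ioc 0 T) φ := by
    refine convexOn_of_hasDerivWithinAt2_nonneg (convex_Ioc 0 T)
      (fun t ht => (hφ1 t ht.1).continuousAt.continuousWithinAt)
      (f' := fun t => Φ' t - c * (t - 1)) (f'' := fun t => Φ'' t - c) ?_ ?_ ?_
    all_goals
      rw [interior_Ioc]
      intro t ht
    · exact (hφ1 t ht.1).hasDerivWithinAt
    · exact (hφ2 t ht.1).hasDerivWithinAt
    · exact sub_nonneg.mpr (hanti ht.1 hT0 ht.2.le)
  have hφ1' : HasDerivAt φ (Φ' 1) 1 := by simpa using hφ1 1 one_pos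
  have key : ∀ t, 0 < t → t ≤ T → Φ 1 + Φ' 1 * (t - 1) + c / 2 * (t - 1) ^ 2 ≤ Φ t := by
    intro t ht htT
    have hφ11 : φ 1 = Φ 1 := by simp [φ]
    have hφt : φ t = Φ t - c / 2 * (t - 1) ^ 2 := rfl
    rcases lt_trichotomy t 1 with h | rfl | h
    · have := hφ.slope_le_of_hasDerivAt ⟨ht, htT⟩ ⟨one_pos, hT⟩ h hφ1'
      rw [slope_def_field, div_le_iff₀ (by linarith)] at this
      linarith
    · simp
    · have := hφ.le_slope_of_hasDerivAt ⟨one_pos, hT⟩ ⟨ht, htT⟩ h hφ1'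
      rw [slope_def_field, le_div_iff₀ (by linarith)] at this
      linarith
  rcases hu0.eq_or_lt with rfl | hu
  · set d := Φ 0 - Φ 1 + Φ' 1 with hd
    have hbound : ∀ t, 0 < t → t < 1 → c / 2 * (1 - t) ≤ d := by
      intro t ht ht1
      have h1 := key t ht (by linarith)
      have h2 := hconv.2 (Set.mem_Ici.mpr le_rfl) (Set.mem_Ici.mpr zero_le_one)
        (by linarith : 0 ≤ 1 - t) ht.le (by ring)
      simp only [smul_eq_mul, mul_zero, mul_one, zero_add] at h2
      refine le_of_mul_le_mul_right ?_ (by linarith : 0 < 1 - t)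
      rw [hd]
      linarith
    have hdc : c / 2 ≤ d := by
      by_contra! hlt
      have hd0 : 0 < d := lt_of_lt_of_le (by linarith) (hbound (1 / 2) (by norm_num) (by norm_num))
      have h1 : d / c < 1 / 2 := by rw [div_lt_iff₀ hpos]; linarith
      have h2 : 0 < d / c := div_pos hd0 hpos
      have h3 := hbound (1 / 2 - d / c) (by linarith) (by linarith)
      have h4 : c * (d / c) = d := mul_div_cancel₀ d hpos.ne'
      linarith
    linarith
  · exact key u hu huT

lemma le_quadratic {Ψ'1 : ℝ} (hΨconc : ConcaveOn ℝ (Set.Ioi 0) (fun u => (Φ u - Φ 0) / u))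
    (hΨ'1 : HasDerivAt (fun u => (Φ u - Φ 0) / u) Ψ'1 1) {u : ℝ} (hu : 0 ≤ u) :
    Φ u ≤ Φ 1 + (Φ 1 - Φ 0 + Ψ'1) * (u - 1) + Ψ'1 * (u - 1) ^ 2 := by
  rcases hu.eq_or_lt with rfl | hu
  · linarith
  have htan : (Φ u - Φ 0) / u ≤ Φ 1 - Φ 0 + Ψ'1 * (u - 1) := by
    rcases lt_trichotomy u 1 with h | rfl | h
    · have := hΨconc.le_slope_of_hasDerivAt hu (Set.mem_Ioi.mpr one_pos) h hΨ'1
      rw [slope_def_field, le_div_iff₀ (by linarith), div_one] at this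
      linarith
    · simp
    · have := hΨconc.slope_le_of_hasDerivAt (Set.mem_Ioi.mpr one_pos) hu h hΨ'1
      rw [slope_def_field, div_le_iff₀ (by linarith), div_one] at this
      linarith
  rw [div_le_iff₀ hu] at htan
  linarith

end ConvexFunction

/-- Theorem: if `Φ : [0,∞) → ℝ` is convex, twice differentiable and strictly convex on
`(0,∞)` with nonincreasing second derivative, and `Ψ(u) = (Φ(u) − Φ(0))/u` is concave
on `(0,∞)` and differentiable at `1`, then for every admissible pair `(μ,K)` on finite
alphabets, `η_Φ(μ,K) ≤ (2Ψ'(1)/Φ''(1/μ*)) · S(μ,K)²`, where `μ* = min_x μ(x)`. -/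
theorem statement3 {X Y : Type} [Fintype X] [Fintype Y] [Nonempty X] [Nonempty Y]
    (Φ Φ' Φ'' : ℝ → ℝ)
    (hconv : ConvexOn ℝ (Set.Ici 0) Φ)
    (hd1 : ∀ u ∈ Set.Ioi (0:ℝ), HasDerivAt Φ (Φ' u) u)
    (hd2 : ∀ u ∈ Set.Ioi (0:ℝ), HasDerivAt Φ' (Φ'' u) u)
    (hstrict : StrictConvexOn ℝ (Set.Ioi 0) Φ)
    (hanti : AntitoneOn Φ'' (Set.Ioi 0))
    (Ψ'1 : ℝ)
    (hΨconc : ConcaveOn ℝ (Set.Ioi 0) (fun u => (Φ u - Φ 0) / u))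
    (hΨ'1 : HasDerivAt (fun u => (Φ u - Φ 0) / u) Ψ'1 1)
    (μ : X → ℝ) (K : X → Y → ℝ) (hμ : IsPosDist μ) (hK : IsChannel K)
    (hadm : ∀ y, 0 < push μ K y) :
    eta Φ μ K ≤ (2 * Ψ'1 / Φ'' (1 / ⨅ x, μ x)) * (maxCorr μ K) ^ 2 := by
  have hbdd : BddBelow (Set.range μ) := (Set.finite_range μ).bddBelow
  obtain ⟨x₀, hx₀⟩ := exists_eq_ciInf_of_finite (f := μ)
  have hle_one : ∀ {p : X → ℝ}, IsDist p → ∀ x, p x ≤ 1 := fun {p} hp x =>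
    hp.2 ▸ single_le_sum (fun i _ => hp.1 i) (mem_univ x)
  have hmin : ∀ x, ⨅ x, μ x ≤ μ x := fun x => ciInf_le hbdd x
  have hm : 0 < ⨅ x, μ x := hx₀ ▸ hμ.1 x₀
  have hT : 1 ≤ 1 / ⨅ x, μ x := by
    rw [le_div_iff₀ hm, one_mul, ← hx₀]
    exact hle_one hμ.isDist x₀
  set T := 1 / ⨅ x, μ x with hTdef
  have hc : 0 < Φ'' T := second_deriv_pos hd1 hd2 hstrict hanti (one_pos.trans_le hT)
  have hlow := fun u => quadratic_le (u := u) hconv hd1 hd2 hanti hT hc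
  have hup := fun u => le_quadratic (u := u) hΨconc hΨ'1
  have hΨ0 : 0 ≤ Ψ'1 := by
    have hΦ'1 : Φ' 1 = Φ 1 - Φ 0 + Ψ'1 := by
      have h := (((hd1 1 (Set.mem_Ioi.mpr one_pos)).sub_const (Φ 0)).div (hasDerivAt_id 1) one_ne_zero).unique hΨ'1
      simp at h
      linarith
    have h0 := hlow 0 le_rfl (by linarith)
    linarith
  refine Real.sSup_le ?_ (by positivity)
  rintro r ⟨ν, hν, hne, rfl⟩
  have hV := chiSq_pos hμ hne
  have hlow' := mul_chiSq_le_fDiv hμ hν (fun x => div_le_div₀ zero_le_one (hle_one hν x) hm (hmin x))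
    hlow
  have hup' := fDiv_le_mul_chiSq (ν := push ν K) (μ := push μ K)
    ⟨hadm, (hμ.isDist.push hK).2⟩ (hν.push hK) hup
  have hchi := mul_le_mul_of_nonneg_left (chiSq_push_le hμ hK hadm hν hne) hΨ0
  rw [div_le_iff₀ ((by positivity : 0 < Φ'' T / 2 * chiSq ν μ).trans_le hlow')]
  calc fDiv Φ (push ν K) (push μ K) ≤ Ψ'1 * (maxCorr μ K ^ 2 * chiSq ν μ) := hup'.trans hchi
    _ = 2 * Ψ'1 / Φ'' T * maxCorr μ K ^ 2 * (Φ'' T / 2 * chiSq ν μ) := by field_simp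
    _ ≤ 2 * Ψ'1 / Φ'' T * maxCorr μ K ^ 2 * fDiv Φ ν μ :=
      mul_le_mul_of_nonneg_left hlow' (by positivity)

end SDPI
end
end

section
/- Let (μ,K) be an admissible pair on finite alphabets X and Y, let (X,Y) ~ μ⊗K, and let a(x,y) = K*(x|y)/μ(x) be the posterior likelihood ratio, where K* is the adjoint channel. Suppose σ² : Y → [0,∞) satisfies Σ_x μ(x)·exp(t(a(x,y) − 1)) ≤ exp(σ²(y)t²/2) for every y ∈ Y and every t ∈ ℝ. Then the relative-entropy SDPI constant satisfies η(μ,K) ≤ 2 Σ_y (μK)(y) σ²(y). -/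
open Finset

noncomputable section

namespace SDPI

variable {X Y : Type} [Fintype X] [Fintype Y]

theorem mul_le_mul_log_sub_add_exp {u : ℝ} (hu : 0 ≤ u) (h : ℝ) :
    u * h ≤ u * Real.log u - u + Real.exp h := by
  rcases hu.eq_or_lt with rfl | hu
  · simpa using (Real.exp_pos h).le
  · have h1 := mul_le_mul_of_nonneg_left (Real.add_one_le_exp (h - Real.log u)) hu.le
    rw [Real.exp_sub, Real.exp_log hu, mul_div_cancel₀ _ hu.ne'] at h1
    linarith

theorem mul_log_le_sq_add {u : ℝ} (hu : 0 ≤ u) :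
    u * Real.log u ≤ (u - 1) ^ 2 + (u - 1) := by
  rcases hu.eq_or_lt with rfl | hu
  · norm_num
  · nlinarith [mul_le_mul_of_nonneg_left (Real.log_le_sub_one_of_pos hu) hu.le]

/-- The Donsker–Varadhan inequality, for test functions normalized by `∑ μ exp h ≤ 1`. -/
theorem sum_mul_le_fDiv_of_sum_exp_le_one {X : Type} [Fintype X] {μ ν : X → ℝ}
    (hμ : ∀ x, 0 < μ x) (hν : IsDist ν) {h : X → ℝ} (hh : ∑ x, μ x * Real.exp (h x) ≤ 1) :
    ∑ x, ν x * h x ≤ fDiv (fun u => u * Real.log u) ν μ := by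
  have key : ∑ x, ν x * h x ≤
      ∑ x, (μ x * (ν x / μ x * Real.log (ν x / μ x)) - ν x + μ x * Real.exp (h x)) := by
    refine Finset.sum_le_sum fun x _ => ?_
    have h1 := mul_le_mul_of_nonneg_left
      (mul_le_mul_log_sub_add_exp (div_nonneg (hν.1 x) (hμ x).le) (h x)) (hμ x).le
    have h2 : μ x * (ν x / μ x) = ν x := mul_div_cancel₀ _ (hμ x).ne'
    calc ν x * h x = μ x * (ν x / μ x * h x) := by rw [← mul_assoc, h2]
      _ ≤ _ := h1
      _ = μ x * (ν x / μ x * Real.log (ν x / μ x)) - μ x * (ν x / μ x)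
          + μ x * Real.exp (h x) := by ring
      _ = _ := by rw [h2]
  rw [Finset.sum_add_distrib, Finset.sum_sub_distrib, hν.2] at key
  simp only [fDiv, Real.log_one, mul_zero, sub_zero]
  linarith

theorem sq_le_of_forall_mul_le {m D s : ℝ}
    (h : ∀ t : ℝ, t * m ≤ D + s * t ^ 2 / 2) : m ^ 2 ≤ 2 * s * D := by
  have hdiscrim := discrim_le_zero (a := s / 2) (b := -m) (c := D) fun t => by
    linarith [h t]
  rw [discrim] at hdiscrim
  linarith

theorem sum_push {X Y : Type} [Fintype X] [Fintype Y] {ν : X → ℝ} {K : X → Y → ℝ}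
    (hν : ∑ x, ν x = 1) (hK : ∀ x, ∑ y, K x y = 1) : ∑ y, push ν K y = 1 := by
  simp only [push]
  rw [Finset.sum_comm]
  simp [← Finset.mul_sum, hK, hν]

/-- Relative entropy is bounded by the chi-squared divergence. -/
theorem fDiv_mul_log_le_sum_sq {Y : Type} [Fintype Y] {p q : Y → ℝ} (hp : IsDist p)
    (hq : IsPosDist q) :
    fDiv (fun u => u * Real.log u) p q ≤ ∑ y, q y * (p y / q y - 1) ^ 2 := by
  have key : ∑ y, q y * (p y / q y * Real.log (p y / q y)) ≤
      ∑ y, (q y * (p y / q y - 1) ^ 2 + (p y - q y)) := by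
    refine Finset.sum_le_sum fun y _ => ?_
    have h1 := mul_le_mul_of_nonneg_left
      (mul_log_le_sq_add (div_nonneg (hp.1 y) (hq.1 y).le)) (hq.1 y).le
    have h2 : q y * (p y / q y) = p y := mul_div_cancel₀ _ (hq.1 y).ne'
    linarith
  rw [Finset.sum_add_distrib, Finset.sum_sub_distrib, hp.2, hq.2] at key
  simp only [fDiv, Real.log_one, mul_zero, sub_zero]
  linarith

theorem push_div_push_sub_one {X Y : Type} [Fintype X] [Fintype Y] {μ ν : X → ℝ}
    (K : X → Y → ℝ) (hμ : ∀ x, 0 < μ x) (hν : ∑ x, ν x = 1) (y : Y) :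
    push ν K y / push μ K y - 1 = ∑ x, ν x * (adjoint μ K y x / μ x - 1) := by
  have h (x : X) : adjoint μ K y x / μ x = K x y / push μ K y := by
    rw [adjoint, div_right_comm, mul_div_cancel_right₀ _ (hμ x).ne']
  simp only [h, mul_sub, mul_one, Finset.sum_sub_distrib, hν, ← mul_div_assoc,
    ← Finset.sum_div]
  rfl

/-- Theorem (subgaussian bound on the relative-entropy SDPI constant): if for every
output symbol `y` the posterior likelihood ratio `a(X,y) = K*(X|y)/μ(X)` is
`σ²(y)`-subgaussian under `X ~ μ`, then `η(μ,K) ≤ 2 E[σ²(Y)]`. -/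
theorem statement6 {X Y : Type} [Fintype X] [Fintype Y] [Nonempty X] [Nonempty Y]
    (μ : X → ℝ) (K : X → Y → ℝ) (hμ : IsPosDist μ) (hK : IsChannel K)
    (hadm : ∀ y, 0 < push μ K y)
    (σ2 : Y → ℝ) (hσ2 : ∀ y, 0 ≤ σ2 y)
    (hsub : ∀ (y : Y) (t : ℝ),
      (∑ x, μ x * Real.exp (t * (adjoint μ K y x / μ x - 1))) ≤
        Real.exp (σ2 y * t ^ 2 / 2)) :
    eta (fun u => u * Real.log u) μ K ≤ 2 * ∑ y, push μ K y * σ2 y := by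
  have hb : 0 ≤ 2 * ∑ y, push μ K y * σ2 y :=
    mul_nonneg zero_le_two (Finset.sum_nonneg fun y _ => mul_nonneg (hadm y).le (hσ2 y))
  refine Real.sSup_le ?_ hb
  rintro r ⟨ν, hν, -, rfl⟩
  set D := fDiv (fun u => u * Real.log u) ν μ
  have hD0 : 0 ≤ D := by
    simpa using sum_mul_le_fDiv_of_sum_exp_le_one hμ.1 hν (h := 0) (by simp [hμ.2])
  have hdev (y : Y) : (push ν K y / push μ K y - 1) ^ 2 ≤ 2 * σ2 y * D := by
    refine sq_le_of_forall_mul_le fun t => ?_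
    have hDV := sum_mul_le_fDiv_of_sum_exp_le_one hμ.1 hν
      (h := fun x => t * (adjoint μ K y x / μ x - 1) - σ2 y * t ^ 2 / 2) (by
        simp only [Real.exp_sub, ← mul_div_assoc, ← Finset.sum_div]
        exact (div_le_one (Real.exp_pos _)).2 (by simpa only [mul_div_assoc] using hsub y t))
    rw [push_div_push_sub_one K hμ.1 hν.2, Finset.mul_sum]
    simp only [mul_sub (ν _) (t * _), Finset.sum_sub_distrib, ← Finset.sum_mul, hν.2,
      mul_left_comm (ν _) t] at hDV
    linarith
  refine div_le_of_le_mul₀ hD0 hb ?_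
  calc fDiv (fun u => u * Real.log u) (push ν K) (push μ K)
      ≤ ∑ y, push μ K y * (push ν K y / push μ K y - 1) ^ 2 :=
        fDiv_mul_log_le_sum_sq
          ⟨fun y => Finset.sum_nonneg fun x _ => mul_nonneg (hν.1 x) (hK.1 x y),
            sum_push hν.2 hK.2⟩ ⟨hadm, sum_push hμ.2 hK.2⟩
    _ ≤ ∑ y, push μ K y * (2 * σ2 y * D) :=
        Finset.sum_le_sum fun y _ => mul_le_mul_of_nonneg_left (hdev y) (hadm y).le
    _ = (2 * ∑ y, push μ K y * σ2 y) * D := by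
        rw [Finset.mul_sum, Finset.sum_mul]
        exact Finset.sum_congr rfl fun y _ => by ring

end SDPI
end
end
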